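/- Let (Ω, 𝓕, P) be a probability space, H : Ω → ℝ a random variable, K > 0 and R > 1, and suppose E[e^{RH}] < ∞. Then E[(e^H − K)^+] = (1/2π) · ∫_ℝ M_H(R−iu) · K^{1+iu−R} / ((iu−R)·(1+iu−R)) du, where M_H(z) = E[e^{zH}]. -/

import Mathlib

open MeasureTheory Complex Real

/-- The Mellin transform of `t ↦ (1 - t)⁺` is `1 / (s (s + 1))` on the right half-plane. -/
lemma hasMellin_max_one_sub {s : ℂ} (hs : 0 < s.re) :
    HasMellin (fun t : ℝ => ((max (1 - t) 0 : ℝ) : ℂ)) s (1 / (s * (s + 1))) := by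
  have h1 := hasMellin_one_Ioc hs
  have h2 := hasMellin_cpow_Ioc 1 (s := s) (by simp only [one_re]; linarith)
  have h := hasMellin_sub h1.1 h2.1
  have hs0 : s ≠ 0 := by rintro rfl; simp at hs
  have hs1 : s + 1 ≠ 0 := by
    intro h0
    have := congrArg Complex.re h0
    simp only [add_re, one_re, zero_re] at this
    linarith
  rw [h1.2, h2.2, show 1 / s - 1 / (s + 1) = 1 / (s * (s + 1)) by field_simp; ring] at h
  have key : Set.EqOn
      (fun t : ℝ => (t : ℂ) ^ (s - 1) •
        ((Set.Ioc (0 : ℝ) 1).indicator (fun _ => (1 : ℂ)) t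
          - (Set.Ioc (0 : ℝ) 1).indicator (fun t : ℝ => (t : ℂ) ^ (1 : ℂ)) t))
      (fun t : ℝ => (t : ℂ) ^ (s - 1) • ((max (1 - t) 0 : ℝ) : ℂ)) (Set.Ioi 0) := by
    intro t ht
    simp only [Set.mem_Ioi] at ht
    dsimp only
    congr 1
    by_cases h' : t ≤ 1
    · have hm : t ∈ Set.Ioc (0 : ℝ) 1 := ⟨ht, h'⟩
      simp [Set.indicator_of_mem hm, h']
    · have hm : t ∉ Set.Ioc (0 : ℝ) 1 := fun hm => h' hm.2
      simp [Set.indicator_of_notMem hm, max_eq_right (by linarith : 1 - t ≤ 0)]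
  exact ⟨h.1.congr_fun key measurableSet_Ioi,
    (setIntegral_congr_fun measurableSet_Ioi key).symm.trans h.2⟩

lemma norm_inv_mul_add_one_le {s : ℂ} (hs : 0 < s.re) :
    ‖(s * (s + 1))⁻¹‖ ≤ (s.re ^ 2 + s.im ^ 2)⁻¹ := by
  have hpos : 0 < s.re ^ 2 + s.im ^ 2 := by positivity
  rw [norm_inv, norm_mul]
  refine inv_anti₀ hpos ?_
  have hle : ‖s‖ ≤ ‖s + 1‖ := by
    rw [Complex.norm_def, Complex.norm_def]
    refine Real.sqrt_le_sqrt ?_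
    simp only [normSq_apply, add_re, one_re, add_im, one_im]
    nlinarith
  calc s.re ^ 2 + s.im ^ 2 = ‖s‖ * ‖s‖ := by rw [norm_mul_self_eq_normSq, normSq_apply]; ring
    _ ≤ ‖s‖ * ‖s + 1‖ := by gcongr

lemma integrable_inv_sq_add_sq {σ : ℝ} (hσ : 0 < σ) :
    Integrable fun v : ℝ => (σ ^ 2 + v ^ 2)⁻¹ := by
  convert (integrable_inv_one_add_sq.comp_div hσ.ne').const_mul (σ ^ 2)⁻¹ using 2 with v
  rw [← mul_inv]
  congr 1
  field_simp

/-- The payoff `(exp y - 1)⁺` as an inverse Laplace integral along a vertical line. -/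
lemma max_exp_sub_one_eq_integral {σ : ℝ} (hσ : 0 < σ) (y : ℝ) :
    ((max (Real.exp y - 1) 0 : ℝ) : ℂ) = (1 / (2 * (π : ℂ))) *
      ∫ u : ℝ, Complex.exp ((σ + 1 - I * u) * y) * ((σ - I * u) * (σ - I * u + 1))⁻¹ := by
  have hre (v : ℝ) : ((σ : ℂ) + v * I).re = σ := by simp
  have hm (v : ℝ) := hasMellin_max_one_sub (s := (σ : ℂ) + v * I) (by rwa [hre])
  have hvert : VerticalIntegrable (mellin fun t : ℝ => ((max (1 - t) 0 : ℝ) : ℂ)) σ := by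
    refine (integrable_inv_sq_add_sq hσ).mono' ?_ (.of_forall fun v => ?_)
    · simp_rw [(hm _).2]
      exact (by fun_prop : Measurable _).aestronglyMeasurable
    · rw [(hm v).2, one_div]
      simpa using norm_inv_mul_add_one_le (s := (σ : ℂ) + v * I) (by rwa [hre])
  have hinv := mellinInv_mellin_eq σ (fun t : ℝ => ((max (1 - t) 0 : ℝ) : ℂ)) (Real.exp_pos (-y))
    (by simpa using (hm 0).1) hvert (by fun_prop)
  have hmax : max (Real.exp y - 1) 0 = Real.exp y * max (1 - Real.exp (-y)) 0 := by
    rw [mul_max_of_nonneg _ _ (Real.exp_pos y).le, mul_sub, ← Real.exp_add]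
    simp
  rw [hmax, ofReal_mul, ← hinv, mellinInv, ← integral_neg_eq_self, Complex.real_smul,
    mul_left_comm, ← integral_const_mul]
  push_cast
  congr 2 with u
  have hmu := (hm (-u)).2
  push_cast at hmu ⊢
  rw [hmu, cpow_def_of_ne_zero (Complex.exp_ne_zero _), smul_eq_mul, ← mul_assoc, one_div]
  rw [← ofReal_neg y, ← ofReal_exp (-y), ← ofReal_log (Real.exp_pos _).le, Real.log_exp,
    ← Complex.exp_add]
  push_cast
  ring_nf

/-- Fourier-based valuation formula for a cap (call): if `H` is a real random variable
with `E[e^{RH}] < ∞`, `K > 0` and `R > 1`, then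
`E[(e^H − K)⁺] = (1/2π) ∫_ℝ M_H(R−iu) · K^{1+iu−R} / ((iu−R)(1+iu−R)) du`,
where `M_H(z) = E[e^{zH}]`. -/
theorem call_valuation_fourier {Ω : Type*} [MeasurableSpace Ω] (P : Measure Ω)
    [IsProbabilityMeasure P] (H : Ω → ℝ) (hH : Measurable H) (K R : ℝ)
    (hK : 0 < K) (hR : 1 < R)
    (hInt : Integrable (fun ω => Real.exp (R * H ω)) P) :
    ((∫ ω, max (Real.exp (H ω) - K) 0 ∂P : ℝ) : ℂ)
      = (1 / (2 * (π : ℂ))) *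
          ∫ u : ℝ, (∫ ω, Complex.exp (((R : ℂ) - Complex.I * u) * H ω) ∂P) *
            Complex.exp ((1 + Complex.I * u - R) * Real.log K) /
              ((Complex.I * u - R) * (1 + Complex.I * u - R)) := by
  obtain ⟨σ, rfl⟩ : ∃ σ, R = σ + 1 := ⟨R - 1, by ring⟩
  have hσ : 0 < σ := by linarith
  set F : Ω → ℝ → ℂ := fun ω u => Complex.exp (((σ + 1 : ℝ) - I * u) * H ω) *
    Complex.exp ((1 + I * u - (σ + 1 : ℝ)) * Real.log K) *
      ((σ - I * u) * (σ - I * u + 1))⁻¹ with hF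
  have hpoint (ω : Ω) : ((max (Real.exp (H ω) - K) 0 : ℝ) : ℂ)
      = (1 / (2 * (π : ℂ))) * ∫ u : ℝ, F ω u := by
    have hmax : max (Real.exp (H ω) - K) 0
        = K * max (Real.exp (H ω - Real.log K) - 1) 0 := by
      rw [mul_max_of_nonneg _ _ hK.le, Real.exp_sub, Real.exp_log hK]
      field_simp
      simp
    rw [hmax, ofReal_mul, max_exp_sub_one_eq_integral hσ, mul_left_comm, ← integral_const_mul]
    congr 2 with u
    have hKexp : (K : ℂ) = Complex.exp (Real.log K : ℝ) := by
      rw [← ofReal_exp, Real.exp_log hK]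
    rw [hF, ← mul_assoc]
    nth_rewrite 1 [hKexp]
    dsimp only
    rw [← Complex.exp_add, ← Complex.exp_add]
    push_cast
    ring_nf
  have hFint : Integrable (Function.uncurry F) (P.prod volume) := by
    refine ((hInt.mul_const (Real.exp (-σ * Real.log K))).mul_prod
      (integrable_inv_sq_add_sq hσ)).mono' ?_ (.of_forall fun z => ?_)
    · exact (by unfold Function.uncurry; fun_prop : Measurable _).aestronglyMeasurable
    · have h := norm_inv_mul_add_one_le (s := (σ : ℂ) - I * z.2) (by simpa using hσ)
      simp only [Function.uncurry, hF]
      rw [norm_mul, norm_mul, Complex.norm_exp, Complex.norm_exp]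
      refine mul_le_mul (le_of_eq ?_) (by simpa using h) (norm_nonneg _) (by positivity)
      simp
  rw [← integral_complex_ofReal]
  simp_rw [hpoint]
  rw [integral_const_mul, integral_integral_swap hFint]
  congr 2 with u
  simp_rw [hF, integral_mul_const]
  rw [div_eq_mul_inv]
  congr 2
  push_cast
  ring
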